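/- Let (A, B) be a co-t-structure on a triangulated category T and ω := A ∩ B. Then U_ω = ω^∧ = A^∧ ∩ B and _ωU = ω^∨ = B^∨ ∩ A. -/

import Mathlib

open CategoryTheory CategoryTheory.Limits CategoryTheory.Pretriangulated

universe v u

variable (C : Type u) [Category.{v} C] [HasZeroObject C] [HasShift C ℤ]
  [Preadditive C] [∀ n : ℤ, (CategoryTheory.shiftFunctor C n).Additive]
  [Pretriangulated C]

namespace CotPaper

variable {C}

/-- The shift `X⟦n⟧` of a class of objects `X` by `n ∈ ℤ`, closed under isomorphism. -/
def shf (X : Set C) (n : ℤ) : Set C := {Z | ∃ A ∈ X, Nonempty (Z ≅ A⟦n⟧)}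

/-- `star X Y` consists of the objects `Z` fitting in a distinguished triangle
`A ⟶ Z ⟶ B ⟶ A⟦1⟧` with `A ∈ X` and `B ∈ Y`. -/
def star (X Y : Set C) : Set C :=
  {Z | ∃ (A B : C) (f : A ⟶ Z) (g : Z ⟶ B) (h : B ⟶ A⟦(1:ℤ)⟧),
    A ∈ X ∧ B ∈ Y ∧ Triangle.mk f g h ∈ distTriang C}

/-- `X^⊥ = {Z : Hom(X', Z) = 0 for all X' ∈ X}`. -/
def rightOrth (X : Set C) : Set C := {Z | ∀ A ∈ X, ∀ f : A ⟶ Z, f = 0}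

/-- `⊥X = {Z : Hom(Z, X') = 0 for all X' ∈ X}`. -/
def leftOrth (X : Set C) : Set C := {Z | ∀ B ∈ X, ∀ f : Z ⟶ B, f = 0}

/-- A class of objects is closed under isomorphisms. -/
def isoClosed (X : Set C) : Prop := ∀ ⦃A B : C⦄, A ∈ X → (A ≅ B) → B ∈ X

/-- A class of objects is closed under direct summands. -/
def summandClosed (X : Set C) : Prop :=
  ∀ ⦃W Z : C⦄, W ∈ X → (∃ (i : Z ⟶ W) (r : W ⟶ Z), i ≫ r = 𝟙 Z) → Z ∈ X

/-- `W` is a direct sum of `A` and `B` (i.e. carries a binary biproduct structure). -/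
def isDirectSum (W A B : C) : Prop :=
  ∃ (iA : A ⟶ W) (iB : B ⟶ W) (pA : W ⟶ A) (pB : W ⟶ B),
    iA ≫ pA = 𝟙 A ∧ iB ≫ pB = 𝟙 B ∧ iA ≫ pB = 0 ∧ iB ≫ pA = 0 ∧
      pA ≫ iA + pB ≫ iB = 𝟙 W

/-- An additive class of objects: it contains a zero object and is closed under
finite (binary) direct sums. -/
def addClosed (X : Set C) : Prop :=
  (∃ Z ∈ X, IsZero Z) ∧ ∀ ⦃A B W : C⦄, A ∈ X → B ∈ X → isDirectSum W A B → W ∈ X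

/-- `X = add X` : `X` is closed under isomorphisms, finite direct sums and direct summands. -/
def isAdd (X : Set C) : Prop := isoClosed X ∧ addClosed X ∧ summandClosed X

/-- A class is suspended if it is closed under `[1]` and under extensions. -/
def suspended (X : Set C) : Prop := shf X 1 ⊆ X ∧ star X X ⊆ X

/-- A class is cosuspended if it is closed under `[-1]` and under extensions. -/
def cosuspended (X : Set C) : Prop := shf X (-1) ⊆ X ∧ star X X ⊆ X

/-- `ε^∧_n(X)`: defined inductively, `ε^∧_0(X) = X` and `Z ∈ ε^∧_{n+1}(X)` iff there is a
distinguished triangle `Z⟦-1⟧ ⟶ W ⟶ A ⟶ Z` (equivalently `W ⟶ A ⟶ Z ⟶ W⟦1⟧`) with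
`W ∈ ε^∧_n(X)` and `A ∈ X`. -/
def epsHat (X : Set C) : ℕ → Set C
  | 0 => X
  | n + 1 =>
    {Z | ∃ (W A : C) (f : W ⟶ A) (g : A ⟶ Z) (h : Z ⟶ W⟦(1:ℤ)⟧),
      W ∈ epsHat X n ∧ A ∈ X ∧ Triangle.mk f g h ∈ distTriang C}

/-- `ε^∨_n(X)`: `ε^∨_0(X) = X` and `Z ∈ ε^∨_{n+1}(X)` iff there is a distinguished
triangle `Z ⟶ A ⟶ K ⟶ Z⟦1⟧` with `A ∈ X` and `K ∈ ε^∨_n(X)`. -/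
def epsCheck (X : Set C) : ℕ → Set C
  | 0 => X
  | n + 1 =>
    {Z | ∃ (A K : C) (f : Z ⟶ A) (g : A ⟶ K) (h : K ⟶ Z⟦(1:ℤ)⟧),
      A ∈ X ∧ K ∈ epsCheck X n ∧ Triangle.mk f g h ∈ distTriang C}

/-- `X^∧ := ∪_{n ≥ 0} ε^∧_n(X)`. -/
def hat (X : Set C) : Set C := ⋃ n : ℕ, epsHat X n

/-- `X^∨ := ∪_{n ≥ 0} ε^∨_n(X)`. -/
def check (X : Set C) : Set C := ⋃ n : ℕ, epsCheck X n

/-- `X~ := (X^∧)^∨`. -/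
def tilde (X : Set C) : Set C := check (hat X)

/-- `resdim_X(M) := min {n : M ∈ ε^∧_n(X)}`, with `min ∅ = ∞`. -/
noncomputable def resdim (X : Set C) (M : C) : ℕ∞ :=
  sInf {n : ℕ∞ | ∃ m : ℕ, n = (m : ℕ∞) ∧ M ∈ epsHat X m}

/-- `coresdim_X(M) := min {n : M ∈ ε^∨_n(X)}`, with `min ∅ = ∞`. -/
noncomputable def coresdim (X : Set C) (M : C) : ℕ∞ :=
  sInf {n : ℕ∞ | ∃ m : ℕ, n = (m : ℕ∞) ∧ M ∈ epsCheck X m}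

/-- `id_X(M) := min {n ∈ ℕ : Hom(-, M[i])|_X = 0 for all i > n}`, with `min ∅ = ∞`. -/
noncomputable def idDim (X : Set C) (M : C) : ℕ∞ :=
  sInf {n : ℕ∞ | ∃ m : ℕ, n = (m : ℕ∞) ∧
    ∀ i : ℤ, (m : ℤ) < i → ∀ A ∈ X, ∀ f : A ⟶ M⟦i⟧, f = 0}

/-- `pd_X(M) := min {n ∈ ℕ : Hom(M[-i], -)|_X = 0 for all i > n}`, with `min ∅ = ∞`. -/
noncomputable def pdDim (X : Set C) (M : C) : ℕ∞ :=
  sInf {n : ℕ∞ | ∃ m : ℕ, n = (m : ℕ∞) ∧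
    ∀ i : ℤ, (m : ℤ) < i → ∀ B ∈ X, ∀ f : M⟦(-i : ℤ)⟧ ⟶ B, f = 0}

/-- `id_X(Y) := sup {id_X(M) : M ∈ Y}`. -/
noncomputable def idDimSet (X Y : Set C) : ℕ∞ := ⨆ M ∈ Y, idDim X M

/-- `pd_X(Y) := sup {pd_X(M) : M ∈ Y}`. -/
noncomputable def pdDimSet (X Y : Set C) : ℕ∞ := ⨆ M ∈ Y, pdDim X M

/-- `ω` is `X`-injective: `id_X(W) = 0` for every `W ∈ ω`. -/
def xInjective (X ω : Set C) : Prop := ∀ W ∈ ω, idDim X W = 0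

/-- `ω` is `X`-projective: `pd_X(W) = 0` for every `W ∈ ω`. -/
def xProjective (X ω : Set C) : Prop := ∀ W ∈ ω, pdDim X W = 0

/-- `ω` is a weak-cogenerator in `X`: `ω ⊆ X ⊆ X[-1] * ω`. -/
def weakCogenerator (ω X : Set C) : Prop := ω ⊆ X ∧ X ⊆ star (shf X (-1)) ω

/-- `ω` is a weak-generator in `X`: `ω ⊆ X ⊆ ω * X[1]`. -/
def weakGenerator (ω X : Set C) : Prop := ω ⊆ X ∧ X ⊆ star ω (shf X 1)

/-- `ω` is silting: `Hom(W, W'[i]) = 0` for all `W, W' ∈ ω` and all `i > 0`. -/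
def silting (ω : Set C) : Prop :=
  ∀ W ∈ ω, ∀ W' ∈ ω, ∀ i : ℤ, 0 < i → ∀ f : W ⟶ W'⟦i⟧, f = 0

/-- A thick subcategory: a (full, additive, isomorphism-closed) triangulated subcategory
closed under direct summands. -/
structure IsThick (S : Set C) : Prop where
  zero : ∃ Z ∈ S, IsZero Z
  iso : isoClosed S
  shift : ∀ n : ℤ, shf S n ⊆ S
  ext : star S S ⊆ S
  summand : summandClosed S

/-- `Δ̄_T(X)`: the smallest thick subcategory containing `X`. -/
def thickClosure (X : Set C) : Set C := ⋂₀ {S : Set C | IsThick S ∧ X ⊆ S}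

/-- `U_ω`: the smallest suspended class containing `ω`. -/
def uPlus (ω : Set C) : Set C := ⋂₀ {S : Set C | suspended S ∧ ω ⊆ S}

/-- `_ωU`: the smallest cosuspended class containing `ω`. -/
def uMinus (ω : Set C) : Set C := ⋂₀ {S : Set C | cosuspended S ∧ ω ⊆ S}

/-- `_ωŪ`: the smallest cosuspended class containing `ω` closed under direct summands. -/
def uMinusBar (ω : Set C) : Set C :=
  ⋂₀ {S : Set C | cosuspended S ∧ summandClosed S ∧ ω ⊆ S}

/-- `(A, B)` is a co-t-structure on the triangulated subcategory `S` of `C`: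
`A` and `B` are full additive subcategories of `S` closed under isomorphisms and direct
summands, `A[-1] ⊆ A`, `B[1] ⊆ B`, `Hom(A[-1], B) = 0` and `S = A[-1] * B`. -/
structure IsCotStructure (S A B : Set C) : Prop where
  subA : A ⊆ S
  subB : B ⊆ S
  isoA : isoClosed A
  isoB : isoClosed B
  addA : addClosed A
  addB : addClosed B
  summandA : summandClosed A
  summandB : summandClosed B
  shiftA : shf A (-1) ⊆ A
  shiftB : shf B 1 ⊆ B
  orth : ∀ A' ∈ shf A (-1), ∀ B' ∈ B, ∀ f : A' ⟶ B', f = 0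
  decomp : S = star (shf A (-1)) B

/-- A relative Auslander-Buchweitz context on `C` : `X` is cosuspended and closed under
direct summands, `Y` is suspended, closed under direct summands and `Y ⊆ X^∧`, and
`ω := X ∩ Y` is an `X`-injective weak-cogenerator in `X`. -/
structure RelativeABContext (X Y : Set C) : Prop where
  cosusp : cosuspended X
  summandX : summandClosed X
  susp : suspended Y
  summandY : summandClosed Y
  sub : Y ⊆ hat X
  inj : xInjective X (X ∩ Y)
  wcog : weakCogenerator (X ∩ Y) X


/-- A family of classes compatible with shifts and closed under extensions. -/
structure GoodFam (P : ℤ → Set C) : Prop where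
  iso : ∀ n, isoClosed (P n)
  mid : ∀ n, ∀ T ∈ distTriang C, T.obj₁ ∈ P n → T.obj₃ ∈ P n → T.obj₂ ∈ P n
  sh : ∀ (n m : ℤ) (Z : C) (k : ℤ), n + k = m → (Z⟦k⟧ ∈ P m ↔ Z ∈ P n)

theorem GoodFam.third {P : ℤ → Set C} (hP : GoodFam P) (n m : ℤ) (hnm : n + 1 = m)
    {T : Triangle C} (hT : T ∈ distTriang C) (h1 : T.obj₁ ∈ P n) (h2 : T.obj₂ ∈ P m) :
    T.obj₃ ∈ P m :=
  hP.mid m _ (rot_of_distTriang _ hT) h2 ((hP.sh n m _ 1 hnm).2 h1)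

theorem GoodFam.first {P : ℤ → Set C} (hP : GoodFam P) (n m : ℤ) (hnm : n + 1 = m)
    {T : Triangle C} (hT : T ∈ distTriang C) (h2 : T.obj₂ ∈ P n) (h3 : T.obj₃ ∈ P m) :
    T.obj₁ ∈ P n :=
  hP.mid n _ (inv_rot_of_distTriang _ hT) ((hP.sh m n _ (-1) (by omega)).2 h3) h2

def LA (B : Set C) (n : ℤ) : Set C := {Z | ∀ b ∈ B, ∀ f : Z ⟶ b⟦n⟧, f = 0}

def RB (A : Set C) (n : ℤ) : Set C := {Z | ∀ a ∈ A, ∀ f : a⟦n⟧ ⟶ Z, f = 0}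

theorem hom_shift_zero {X Y X' Y' : C} (k : ℤ) (eX : X' ≅ X⟦k⟧) (eY : Y' ≅ Y⟦k⟧) :
    (∀ f : X' ⟶ Y', f = 0) ↔ (∀ f : X ⟶ Y, f = 0) := by
  constructor
  · intro H f
    apply (shiftFunctor C k).map_injective
    have h1 := H (eX.hom ≫ f⟦k⟧' ≫ eY.inv)
    have h2 : f⟦k⟧' = eX.inv ≫ (eX.hom ≫ f⟦k⟧' ≫ eY.inv) ≫ eY.hom := by simp
    rw [h2, h1]; simp
  · intro H f
    obtain ⟨g, hg⟩ := (shiftFunctor C k).map_surjective (eX.inv ≫ f ≫ eY.hom)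
    have h2 : f = eX.hom ≫ (eX.inv ≫ f ≫ eY.hom) ≫ eY.inv := by simp
    rw [h2, ← hg, H g]; simp

theorem goodLA (B : Set C) : GoodFam (LA B) where
  iso n X Y hX e b hb f := by
    have := hX b hb (e.hom ≫ f)
    rw [← cancel_epi e.hom, this]; simp
  mid n T hT h1 h3 b hb f := by
    obtain ⟨g, hg⟩ := Triangle.yoneda_exact₂ T hT f (h1 b hb _)
    rw [hg, h3 b hb g]; simp
  sh n m Z k hk := by
    refine forall₂_congr fun b _ => ?_
    exact hom_shift_zero k (Iso.refl _) ((shiftFunctorAdd' C n k m hk).app b)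

theorem goodRB (A : Set C) : GoodFam (RB A) where
  iso n X Y hX e b hb f := by
    have := hX b hb (f ≫ e.inv)
    rw [← cancel_mono e.inv, this]; simp
  mid n T hT h1 h3 b hb f := by
    obtain ⟨g, hg⟩ := Triangle.coyoneda_exact₂ T hT f (h3 b hb _)
    rw [hg, h1 b hb g]; simp
  sh n m Z k hk := by
    refine forall₂_congr fun b _ => ?_
    exact hom_shift_zero k ((shiftFunctorAdd' C n k m hk).app b) (Iso.refl _)

theorem LA_succ {B : Set C} (hB : shf B 1 ⊆ B) (n : ℤ) : LA B n ⊆ LA B (n + 1) := by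
  intro Z hZ b hb
  refine (hom_shift_zero 0 ((shiftFunctorZero C ℤ).symm.app Z) ?_).2
    (hZ (b⟦(1:ℤ)⟧) (hB ⟨b, hb, ⟨Iso.refl _⟩⟩))
  exact (shiftFunctorAdd' C 1 n (n+1) (by omega)).app b ≪≫
    (shiftFunctorZero C ℤ).symm.app _

theorem RB_pred {A : Set C} (hA : shf A (-1) ⊆ A) (n : ℤ) : RB A n ⊆ RB A (n - 1) := by
  intro Z hZ b hb
  refine (hom_shift_zero 0 ?_ ((shiftFunctorZero C ℤ).symm.app Z)).2
    (hZ (b⟦(-1:ℤ)⟧) (hA ⟨b, hb, ⟨Iso.refl _⟩⟩))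
  exact (shiftFunctorAdd' C (-1) n (n-1) (by omega)).app b ≪≫
    (shiftFunctorZero C ℤ).symm.app _

theorem LA_mono {B : Set C} (hB : shf B 1 ⊆ B) (n m : ℤ) (h : n ≤ m) : LA B n ⊆ LA B m := by
  obtain ⟨k, rfl⟩ := Int.le.dest h
  clear h
  induction k with
  | zero => simp
  | succ k ih =>
    have := LA_succ hB (n + k)
    push_cast
    rw [← add_assoc]
    exact ih.trans this

theorem RB_anti {A : Set C} (hA : shf A (-1) ⊆ A) (n m : ℤ) (h : n ≤ m) : RB A m ⊆ RB A n := by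
  obtain ⟨k, rfl⟩ := Int.le.dest h
  clear h
  induction k with
  | zero => simp
  | succ k ih =>
    have := RB_pred hA (n + (k + 1 : ℕ))
    refine this.trans ?_
    have e : n + ((k + 1 : ℕ) : ℤ) - 1 = n + k := by push_cast; ring
    rw [e]
    exact ih

section
variable {A B : Set C} (h : IsCotStructure Set.univ A B)

theorem A_sub (h : IsCotStructure Set.univ A B) : A ⊆ LA B 1 := by
  intro a ha b hb
  refine (hom_shift_zero (-1) (Iso.refl _) ((shiftShiftNeg b (1:ℤ)).symm)).1 ?_
  exact h.orth _ ⟨a, ha, ⟨Iso.refl _⟩⟩ b hb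

theorem B_sub (h : IsCotStructure Set.univ A B) : B ⊆ RB A (-1) := by
  intro b hb a ha
  exact h.orth _ ⟨a, ha, ⟨Iso.refl _⟩⟩ b hb

theorem shf_shift (h : IsCotStructure Set.univ A B) {A' : C} (hA : A' ∈ shf A (-1)) :
    A'⟦(1:ℤ)⟧ ∈ A := by
  obtain ⟨a, ha, ⟨e⟩⟩ := hA
  exact h.isoA ha (((shiftFunctor C (1:ℤ)).mapIso e ≪≫ shiftNegShift a (1:ℤ)).symm)

theorem dec1 (h : IsCotStructure Set.univ A B) (Z : C) :
    ∃ (W X : C) (f : W ⟶ X) (g : X ⟶ Z) (k : Z ⟶ W⟦(1:ℤ)⟧),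
      W ∈ B ∧ X ∈ A ∧ Triangle.mk f g k ∈ distTriang C := by
  have : Z⟦(-1:ℤ)⟧ ∈ star (shf A (-1)) B := h.decomp ▸ Set.mem_univ _
  obtain ⟨A', B0, f, g, k, hA', hB0, hT⟩ := this
  have hT2 := rot_of_distTriang _ (rot_of_distTriang _ hT)
  let e : Z⟦(-1:ℤ)⟧⟦(1:ℤ)⟧ ≅ Z := shiftNegShift Z (1:ℤ)
  refine ⟨B0, A'⟦(1:ℤ)⟧, k, (-f⟦(1:ℤ)⟧') ≫ e.hom, e.inv ≫ (-g⟦(1:ℤ)⟧'), hB0, shf_shift h hA', ?_⟩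
  refine isomorphic_distinguished _ hT2 _ ?_
  refine Triangle.isoMk _ _ (Iso.refl _) (Iso.refl _) e.symm ?_ ?_ ?_
  · change k ≫ 𝟙 _ = 𝟙 _ ≫ k
    rw [Category.comp_id, Category.id_comp]
  · change ((-f⟦(1:ℤ)⟧') ≫ e.hom) ≫ e.inv = 𝟙 _ ≫ (-f⟦(1:ℤ)⟧')
    rw [Category.assoc, e.hom_inv_id, Category.comp_id, Category.id_comp]
  · change (e.inv ≫ (-g⟦(1:ℤ)⟧')) ≫ (𝟙 B0)⟦(1:ℤ)⟧' = e.inv ≫ (-g⟦(1:ℤ)⟧')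
    rw [CategoryTheory.Functor.map_id, Category.comp_id]

theorem dec2 (h : IsCotStructure Set.univ A B) (Z : C) :
    ∃ (X K : C) (f : Z ⟶ X) (g : X ⟶ K) (k : K ⟶ Z⟦(1:ℤ)⟧),
      X ∈ B ∧ K ∈ A ∧ Triangle.mk f g k ∈ distTriang C := by
  have : Z ∈ star (shf A (-1)) B := h.decomp ▸ Set.mem_univ _
  obtain ⟨A', B0, f, g, k, hA', hB0, hT⟩ := this
  exact ⟨B0, A'⟦(1:ℤ)⟧, g, k, -f⟦(1:ℤ)⟧', hB0, shf_shift h hA', rot_of_distTriang _ hT⟩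

theorem A_eq (h : IsCotStructure Set.univ A B) : A = LA B 1 := by
  refine (A_sub h).antisymm fun Z hZ => ?_
  obtain ⟨W, X, f, g, k, hW, hX, hT⟩ := dec1 h Z
  obtain ⟨i, hi⟩ := Triangle.coyoneda_exact₃ _ hT (𝟙 Z) (by
    change 𝟙 Z ≫ k = 0
    rw [hZ W hW k, comp_zero])
  exact h.summandA hX ⟨i, g, hi.symm⟩

theorem B_eq (h : IsCotStructure Set.univ A B) : B = RB A (-1) := by
  refine (B_sub h).antisymm fun Z hZ => ?_
  have : Z ∈ star (shf A (-1)) B := h.decomp ▸ Set.mem_univ _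
  obtain ⟨A', B0, f, g, k, ⟨a, ha, ⟨e⟩⟩, hB0, hT⟩ := this
  have hf : f = 0 := by
    rw [← cancel_epi e.inv, hZ a ha (e.inv ≫ f)]; simp
  obtain ⟨i, hi⟩ := Triangle.yoneda_exact₂ _ hT (𝟙 Z) (by
    change f ≫ 𝟙 Z = 0
    rw [hf, zero_comp])
  exact h.summandB hB0 ⟨g, i, hi.symm⟩

theorem epsHat_mono {X Y : Set C} (hXY : X ⊆ Y) (n : ℕ) : epsHat X n ⊆ epsHat Y n := by
  induction n with
  | zero => exact hXY
  | succ n ih =>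
    rintro Z ⟨W, X, f, g, k, hW, hX, hT⟩
    exact ⟨W, X, f, g, k, ih hW, hXY hX, hT⟩

theorem epsCheck_mono {X Y : Set C} (hXY : X ⊆ Y) (n : ℕ) :
    epsCheck X n ⊆ epsCheck Y n := by
  induction n with
  | zero => exact hXY
  | succ n ih =>
    rintro Z ⟨W, X, f, g, k, hW, hX, hT⟩
    exact ⟨W, X, f, g, k, hXY hW, ih hX, hT⟩

theorem epsHat_sub_LA (h : IsCotStructure Set.univ A B) (n : ℕ) :
    epsHat A n ⊆ LA B (n + 1) := by
  induction n with
  | zero => simpa [epsHat] using A_sub h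
  | succ n ih =>
    rintro Z ⟨W, X, f, g, k, hW, hX, hT⟩
    exact (goodLA B).third (n + 1) _ (by push_cast; ring) hT (ih hW)
      (LA_mono h.shiftB 1 _ (by push_cast; omega) (A_sub h hX))

theorem epsCheck_sub_RB (h : IsCotStructure Set.univ A B) (n : ℕ) :
    epsCheck B n ⊆ RB A (-1 - n) := by
  induction n with
  | zero => simpa [epsCheck] using B_sub h
  | succ n ih =>
    rintro Z ⟨X, K, f, g, k, hX, hK, hT⟩
    exact (goodRB A).first _ (-1 - n) (by push_cast; ring) hT
      (RB_anti h.shiftA _ (-1) (by push_cast; omega) (B_sub h hX)) (ih hK)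

theorem epsHat_sub_B (h : IsCotStructure Set.univ A B) (n : ℕ) :
    epsHat (A ∩ B) n ⊆ B := by
  induction n with
  | zero => exact Set.inter_subset_right
  | succ n ih =>
    rintro Z ⟨W, X, f, g, k, hW, hX, hT⟩
    rw [B_eq h]
    exact (goodRB A).third (-2) (-1) (by norm_num) hT
      (RB_anti h.shiftA _ (-1) (by norm_num) (B_sub h (ih hW))) (B_sub h hX.2)

theorem epsCheck_sub_A (h : IsCotStructure Set.univ A B) (n : ℕ) :
    epsCheck (A ∩ B) n ⊆ A := by
  induction n with
  | zero => exact Set.inter_subset_left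
  | succ n ih =>
    rintro Z ⟨X, K, f, g, k, hX, hK, hT⟩
    rw [A_eq h]
    exact (goodLA B).first 1 2 (by norm_num) hT
      (A_sub h hX.1) (LA_mono h.shiftB 1 _ (by norm_num) (A_sub h (ih hK)))

theorem LA_sub_epsHat (h : IsCotStructure Set.univ A B) (n : ℕ) :
    LA B (n + 1) ∩ B ⊆ epsHat (A ∩ B) n := by
  induction n with
  | zero =>
    rintro Z ⟨h1, h2⟩
    exact ⟨by rw [A_eq h]; simpa using h1, h2⟩
  | succ n ih =>
    rintro Z ⟨h1, h2⟩
    obtain ⟨W, X, f, g, k, hW, hX, hT⟩ := dec1 h Z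
    refine ⟨W, X, f, g, k, ih ⟨?_, hW⟩, ⟨hX, ?_⟩, hT⟩
    · exact (goodLA B).first (n + 1) _ (by push_cast; ring) hT
        (LA_mono h.shiftB 1 _ (by omega) (A_sub h hX)) h1
    · rw [B_eq h]
      exact (goodRB A).mid _ _ hT (B_sub h hW) (B_sub h h2)

theorem RB_sub_epsCheck (h : IsCotStructure Set.univ A B) (n : ℕ) :
    RB A (-1 - n) ∩ A ⊆ epsCheck (A ∩ B) n := by
  induction n with
  | zero =>
    rintro Z ⟨h1, h2⟩
    exact ⟨h2, by rw [B_eq h]; simpa using h1⟩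
  | succ n ih =>
    rintro Z ⟨h1, h2⟩
    obtain ⟨X, K, f, g, k, hX, hK, hT⟩ := dec2 h Z
    refine ⟨X, K, f, g, k, ⟨?_, hX⟩, ih ⟨?_, hK⟩, hT⟩
    · rw [A_eq h]
      exact (goodLA B).mid _ _ hT (A_sub h h2) (A_sub h hK)
    · exact (goodRB A).third _ (-1 - n) (by push_cast; ring) hT h1
        (RB_anti h.shiftA _ (-1) (by omega) (B_sub h hX))

theorem hat_eq (h : IsCotStructure Set.univ A B) : hat (A ∩ B) = hat A ∩ B := by
  ext Z
  simp only [hat, Set.mem_inter_iff, Set.mem_iUnion]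
  constructor
  · rintro ⟨n, hn⟩
    exact ⟨⟨n, epsHat_mono Set.inter_subset_left n hn⟩, epsHat_sub_B h n hn⟩
  · rintro ⟨⟨n, hn⟩, hB⟩
    exact ⟨n, LA_sub_epsHat h n ⟨epsHat_sub_LA h n hn, hB⟩⟩

theorem check_eq (h : IsCotStructure Set.univ A B) : check (A ∩ B) = check B ∩ A := by
  ext Z
  simp only [check, Set.mem_inter_iff, Set.mem_iUnion]
  constructor
  · rintro ⟨n, hn⟩
    exact ⟨⟨n, epsCheck_mono Set.inter_subset_right n hn⟩, epsCheck_sub_A h n hn⟩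
  · rintro ⟨⟨n, hn⟩, hB⟩
    exact ⟨n, RB_sub_epsCheck h n ⟨epsCheck_sub_RB h n hn, hB⟩⟩

theorem mem_hat (h : IsCotStructure Set.univ A B) (Z : C) :
    Z ∈ hat (A ∩ B) ↔ (∃ n : ℕ, Z ∈ LA B (n + 1)) ∧ Z ∈ B := by
  simp only [hat, Set.mem_iUnion]
  constructor
  · rintro ⟨n, hn⟩
    exact ⟨⟨n, epsHat_sub_LA h n (epsHat_mono Set.inter_subset_left n hn)⟩, epsHat_sub_B h n hn⟩
  · rintro ⟨⟨n, hn⟩, hB⟩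
    exact ⟨n, LA_sub_epsHat h n ⟨hn, hB⟩⟩

theorem mem_check (h : IsCotStructure Set.univ A B) (Z : C) :
    Z ∈ check (A ∩ B) ↔ (∃ n : ℕ, Z ∈ RB A (-1 - n)) ∧ Z ∈ A := by
  simp only [check, Set.mem_iUnion]
  constructor
  · rintro ⟨n, hn⟩
    exact ⟨⟨n, epsCheck_sub_RB h n (epsCheck_mono Set.inter_subset_right n hn)⟩,
      epsCheck_sub_A h n hn⟩
  · rintro ⟨⟨n, hn⟩, hB⟩
    exact ⟨n, RB_sub_epsCheck h n ⟨hn, hB⟩⟩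

theorem uPlus_eq (h : IsCotStructure Set.univ A B) : uPlus (A ∩ B) = hat (A ∩ B) := by
  apply Set.Subset.antisymm
  · apply Set.sInter_subset_of_mem
    refine ⟨⟨?_, ?_⟩, fun Z hZ => Set.mem_iUnion.2 ⟨0, hZ⟩⟩
    · rintro Z ⟨X, hX, ⟨e⟩⟩
      rw [mem_hat h] at hX ⊢
      obtain ⟨⟨n, hn⟩, hB⟩ := hX
      refine ⟨⟨n + 1, (goodLA B).iso _ (((goodLA B).sh _ _ _ _ ?_).2 hn) e.symm⟩,
        h.shiftB ⟨X, hB, ⟨e⟩⟩⟩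
      push_cast; ring
    · rintro Z ⟨X, Y, f, g, k, hX, hY, hT⟩
      rw [mem_hat h] at hX hY ⊢
      obtain ⟨⟨n, hn⟩, hB⟩ := hX
      obtain ⟨⟨m, hm⟩, hB'⟩ := hY
      refine ⟨⟨n + m, (goodLA B).mid _ _ hT
        (LA_mono h.shiftB _ _ (by push_cast; omega) hn)
        (LA_mono h.shiftB _ _ (by push_cast; omega) hm)⟩, ?_⟩
      rw [B_eq h]
      exact (goodRB A).mid _ _ hT (B_sub h hB) (B_sub h hB')
  · rintro Z hZ S ⟨⟨hS1, hS2⟩, hS⟩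
    obtain ⟨n, hn⟩ := Set.mem_iUnion.1 hZ
    clear hZ
    induction n generalizing Z with
    | zero => exact hS hn
    | succ n ih =>
      obtain ⟨W, X, f, g, k, hW, hX, hT⟩ := hn
      exact hS2 ⟨X, W⟦(1:ℤ)⟧, g, k, -f⟦(1:ℤ)⟧', hS hX, hS1 ⟨W, ih hW, ⟨Iso.refl _⟩⟩,
        rot_of_distTriang _ hT⟩

theorem uMinus_eq (h : IsCotStructure Set.univ A B) : uMinus (A ∩ B) = check (A ∩ B) := by
  apply Set.Subset.antisymm
  · apply Set.sInter_subset_of_mem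
    refine ⟨⟨?_, ?_⟩, fun Z hZ => Set.mem_iUnion.2 ⟨0, hZ⟩⟩
    · rintro Z ⟨X, hX, ⟨e⟩⟩
      rw [mem_check h] at hX ⊢
      obtain ⟨⟨n, hn⟩, hB⟩ := hX
      refine ⟨⟨n + 1, (goodRB A).iso _ (((goodRB A).sh _ _ _ _ ?_).2 hn) e.symm⟩,
        h.shiftA ⟨X, hB, ⟨e⟩⟩⟩
      push_cast; ring
    · rintro Z ⟨X, Y, f, g, k, hX, hY, hT⟩
      rw [mem_check h] at hX hY ⊢
      obtain ⟨⟨n, hn⟩, hB⟩ := hX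
      obtain ⟨⟨m, hm⟩, hB'⟩ := hY
      refine ⟨⟨n + m, (goodRB A).mid _ _ hT
        (RB_anti h.shiftA _ _ (by push_cast; omega) hn)
        (RB_anti h.shiftA _ _ (by push_cast; omega) hm)⟩, ?_⟩
      rw [A_eq h]
      exact (goodLA B).mid _ _ hT (A_sub h hB) (A_sub h hB')
  · rintro Z hZ S ⟨⟨hS1, hS2⟩, hS⟩
    obtain ⟨n, hn⟩ := Set.mem_iUnion.1 hZ
    clear hZ
    induction n generalizing Z with
    | zero => exact hS hn
    | succ n ih =>
      obtain ⟨X, K, f, g, k, hX, hK, hT⟩ := hn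
      exact hS2 ⟨_, _, _, _, _, hS1 ⟨K, ih hK, ⟨Iso.refl _⟩⟩, hS hX,
        inv_rot_of_distTriang _ hT⟩

end

/-- If `(A, B)` is a co-t-structure on `T` and `ω := A ∩ B`, then
`U_ω = ω^∧ = A^∧ ∩ B` and `_ωU = ω^∨ = B^∨ ∩ A`. -/
theorem stmt5 (A B : Set C) (h : IsCotStructure Set.univ A B) :
    (uPlus (A ∩ B) = hat (A ∩ B) ∧ hat (A ∩ B) = hat A ∩ B) ∧
    (uMinus (A ∩ B) = check (A ∩ B) ∧ check (A ∩ B) = check B ∩ A) := by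
  exact ⟨⟨uPlus_eq h, hat_eq h⟩, uMinus_eq h, check_eq h⟩

end CotPaper
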